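/- arXiv:2604.26490 — 2 statements merged into one kernel-verified Lean document; each statement's English description precedes it below -/
import Mathlib

section
/- Let X ⊆ ℝⁿ be a nonempty proper closed set with 0 ∈ X, and let v ∈ V₀(X) be a unit normal direction. Suppose there exists a sequence x_ν ∈ X with x_ν → 0, ⟨x_ν, v⟩ > 0 for all ν, and ‖x_ν‖²/⟨x_ν, v⟩ → 0 (this holds in particular when the directional curvature satisfies θ_v(X,0) < 2 in the definable setting). Then 0 ∈ closure(M_X) and v belongs to the Peano tangent cone C₀(closure(M_X)). -/
open Filter Topology Metric

noncomputable section

local notation "⟪" x ", " y "⟫" => @inner ℝ _ _ x y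

/-- The set of nearest points of `X` to `a`. -/
def nearestPts {E : Type*} [NormedAddCommGroup E] (X : Set E) (a : E) : Set E :=
  {x | x ∈ X ∧ dist a x = Metric.infDist a X}

/-- The medial axis of `X`: points with at least two nearest points in `X`. -/
def medialAxis {E : Type*} [NormedAddCommGroup E] (X : Set E) : Set E :=
  {a | ∃ x ∈ nearestPts X a, ∃ y ∈ nearestPts X a, x ≠ y}

/-- The Peano tangent cone of `S` at `a`. -/
def peanoCone {E : Type*} [NormedAddCommGroup E] [NormedSpace ℝ E] (S : Set E) (a : E) :
    Set E :=
  {v | ∃ (x : ℕ → E) (l : ℕ → ℝ), (∀ ν, x ν ∈ S) ∧ Tendsto x atTop (𝓝 a) ∧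
    (∀ ν, 0 < l ν) ∧ Tendsto (fun ν => l ν • (x ν - a)) atTop (𝓝 v)}

/-- Normalising a small relative perturbation of a positive multiple of a unit vector. -/
theorem norm_inv_norm_smul_sub_le {E : Type*} [NormedAddCommGroup E] [NormedSpace ℝ E]
    {v p : E} (hv : ‖v‖ = 1) {s δ : ℝ} (hδ : δ ≤ 1 / 2) (hs : 0 < s) (hp : ‖p‖ ≤ δ * s) :
    s / 2 ≤ ‖s • v - p‖ ∧ ‖‖s • v - p‖⁻¹ • (s • v - p) - v‖ ≤ 4 * δ := by
  have hsv : ‖s • v‖ = s := by rw [norm_smul, hv, Real.norm_of_nonneg hs.le, mul_one]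
  set w := s • v - p with hw
  have habs : |‖w‖ - s| ≤ δ * s := by
    have := abs_norm_sub_norm_le w (s • v)
    rw [hsv] at this
    refine this.trans ?_
    rwa [hw, sub_sub_cancel_left, norm_neg]
  have hhalf : s / 2 ≤ ‖w‖ := by
    have := (abs_le.1 habs).1
    nlinarith
  refine ⟨hhalf, ?_⟩
  have hw0 : 0 < ‖w‖ := by linarith
  have heq : ‖w‖⁻¹ • w - v = ‖w‖⁻¹ • ((s - ‖w‖) • v - p) := by
    rw [sub_smul, smul_sub, smul_sub, smul_sub, inv_smul_smul₀ hw0.ne', hw]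
    abel
  rw [heq, norm_smul, norm_inv, norm_norm, inv_mul_le_iff₀ hw0]
  have h1 := norm_sub_le ((s - ‖w‖) • v) p
  rw [norm_smul, hv, mul_one, Real.norm_eq_abs, abs_sub_comm] at h1
  have hδ0 : 0 ≤ δ := by
    by_contra! h
    nlinarith [norm_nonneg p]
  nlinarith [mul_le_mul_of_nonneg_left hhalf hδ0]

section MedialAxis

variable {E : Type*} [NormedAddCommGroup E] [ProperSpace E]

/-- Nearest points depend continuously on the base point where they are unique. -/
theorem eventually_dist_nearestPts_lt {X : Set E} (hX : IsClosed X) {b p : E}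
    (hp : p ∈ nearestPts X b) (hb : b ∉ medialAxis X) {η : ℝ} (hη : 0 < η) :
    ∀ᶠ b' in 𝓝 b, ∀ q ∈ nearestPts X b', dist q p < η := by
  by_contra hcon
  obtain ⟨f, hf, hfq⟩ := exists_seq_forall_of_frequently (Filter.not_eventually.1 hcon)
  push Not at hfq
  choose q hq hqp using hfq
  have hdist : Tendsto (fun k => dist (f k) (q k)) atTop (𝓝 (infDist b X)) := by
    simp only [fun k => (hq k).2]
    exact ((continuous_infDist_pt X).tendsto b).comp hf
  have hbdd : Bornology.IsBounded (Set.range q) := by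
    obtain ⟨C, hC⟩ := hdist.bddAbove_range
    obtain ⟨D, hD⟩ := hf.dist (tendsto_const_nhds (x := b)) |>.bddAbove_range
    refine (isBounded_iff_subset_closedBall b).2 ⟨C + D, ?_⟩
    rintro _ ⟨k, rfl⟩
    have h1 := hC ⟨k, rfl⟩
    have h2 := hD ⟨k, rfl⟩
    have h3 := dist_triangle_left (q k) b (f k)
    simp only [mem_closedBall]
    linarith
  obtain ⟨z, -, φ, hφ, hz⟩ := tendsto_subseq_of_bounded hbdd (fun k => ⟨k, rfl⟩)
  have hzX : z ∈ X := hX.mem_of_tendsto hz (Eventually.of_forall fun k => (hq (φ k)).1)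
  have hzb : dist b z = infDist b X :=
    tendsto_nhds_unique ((hf.comp hφ.tendsto_atTop).dist hz) (hdist.comp hφ.tendsto_atTop)
  have hzp : η ≤ dist z p :=
    ge_of_tendsto (hz.dist tendsto_const_nhds) (Eventually.of_forall fun k => hqp (φ k))
  refine hb ⟨z, ⟨hzX, hzb⟩, p, hp, ?_⟩
  rintro rfl
  simp only [dist_self] at hzp
  linarith

variable [InnerProductSpace ℝ E]

/-- Off the medial axis, the distance function grows with slope at least any `c < 1`
in the direction pointing away from the nearest point. -/
theorem exists_infDist_ge_add_mul {X : Set E} (hX : IsClosed X) (hne : X.Nonempty) {b : E}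
    (hbX : b ∉ X) (hb : b ∉ medialAxis X) {c : ℝ} (hc0 : 0 ≤ c) (hc : c < 1) {ρ : ℝ}
    (hρ : 0 < ρ) :
    ∃ b', 0 < dist b' b ∧ dist b' b < ρ ∧ infDist b X + c * dist b' b ≤ infDist b' X := by
  obtain ⟨p, hpX, hp⟩ := hX.exists_infDist_eq_dist hne b
  have hd : 0 < infDist b X := (hX.notMem_iff_infDist_pos hne).1 hbX
  set d := infDist b X with hd_def
  have hnorm : ‖b - p‖ = d := by rw [← dist_eq_norm, hp]
  set u : E := d⁻¹ • (b - p) with hu_def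
  have hu : ‖u‖ = 1 := by
    rw [hu_def, norm_smul, hnorm, norm_inv, Real.norm_of_nonneg hd.le, inv_mul_cancel₀ hd.ne']
  have hup : ⟪u, b - p⟫ = d := by
    rw [hu_def, real_inner_smul_left, real_inner_self_eq_norm_sq, hnorm]
    field_simp
  have hη : 0 < (1 - c) * d := by nlinarith
  have hev := eventually_dist_nearestPts_lt hX ⟨hpX, hp.symm⟩ hb hη
  have hlim : Tendsto (fun h : ℝ => b + h • u) (𝓝 0) (𝓝 b) := by
    have : Continuous (fun h : ℝ => b + h • u) := by fun_prop
    simpa using this.tendsto 0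
  have hev' : ∀ᶠ h in 𝓝[>] (0 : ℝ), (∀ q ∈ nearestPts X (b + h • u), dist q p < (1 - c) * d) :=
    (hlim.eventually hev).filter_mono nhdsWithin_le_nhds
  obtain ⟨h, hh, hh0, hhρ⟩ := (hev'.and (Ioo_mem_nhdsGT hρ)).exists
  have hdist : dist (b + h • u) b = h := by
    rw [dist_eq_norm, add_sub_cancel_left, norm_smul, hu, Real.norm_of_nonneg hh0.le, mul_one]
  refine ⟨b + h • u, by rwa [hdist], by rwa [hdist], ?_⟩
  rw [hdist]
  obtain ⟨q, hqX, hq⟩ := hX.exists_infDist_eq_dist hne (b + h • u)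
  have hqp := hh q ⟨hqX, hq.symm⟩
  have hbq : d ≤ ‖b - q‖ := by
    rw [← dist_eq_norm]; exact infDist_le_dist_of_mem hqX
  have hin : c * d ≤ ⟪u, b - q⟫ := by
    have h1 : ⟪u, b - q⟫ = d - ⟪u, q - p⟫ := by
      rw [← hup, ← inner_sub_right]; congr 1; abel
    have h2 := real_inner_le_norm u (q - p)
    rw [hu, one_mul, ← dist_eq_norm] at h2
    linarith
  have hsq : ‖b + h • u - q‖ ^ 2 = ‖b - q‖ ^ 2 + 2 * (h * ⟪u, b - q⟫) + h ^ 2 := by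
    have : b + h • u - q = (b - q) + h • u := by abel
    rw [this, norm_add_sq_real, inner_smul_right, real_inner_comm, norm_smul, hu,
      Real.norm_of_nonneg hh0.le, mul_one]
  rw [hq, dist_eq_norm]
  refine le_of_sq_le_sq ?_ (norm_nonneg _)
  rw [hsq]
  nlinarith [mul_le_mul_of_nonneg_left hin hh0.le, mul_nonneg hc0 (sub_nonneg.2 hc.le),
    mul_self_nonneg h, mul_nonneg (mul_self_nonneg h) (by nlinarith : 0 ≤ 1 - c ^ 2)]

/-- On a closed ball off the medial axis, the distance function attains its largest possible
growth on the boundary sphere, up to a factor `c < 1`. -/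
theorem exists_infDist_ge_add_mul_of_disjoint {X : Set E} (hX : IsClosed X) (hne : X.Nonempty)
    {a : E} (haX : a ∉ X) {ρ : ℝ} (hρ : 0 < ρ)
    (hdisj : Disjoint (closedBall a ρ) (medialAxis X)) {c : ℝ} (hc0 : 0 < c) (hc : c < 1) :
    ∃ b ∈ sphere a ρ, infDist a X + c * ρ ≤ infDist b X := by
  have hcont := continuous_infDist_pt X
  have hS : IsCompact (closedBall a ρ ∩ {b | infDist a X + c * dist b a ≤ infDist b X}) :=
    (isCompact_closedBall a ρ).inter_right (isClosed_le (by fun_prop) hcont)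
  obtain ⟨b, ⟨hbρ, hb⟩, hmax⟩ := hS.exists_isMaxOn
    ⟨a, mem_closedBall_self hρ.le, by simp⟩ hcont.continuousOn
  simp only [Set.mem_ofPred_eq] at hb
  rcases (mem_closedBall.1 hbρ).lt_or_eq with hlt | heq
  · exfalso
    have hd : 0 < infDist a X := (hX.notMem_iff_infDist_pos hne).1 haX
    have hbX : b ∉ X := by
      rw [hX.notMem_iff_infDist_pos hne]
      have := mul_nonneg hc0.le (dist_nonneg (x := b) (y := a))
      linarith
    obtain ⟨b', hb'0, hb'ρ, hb'⟩ := exists_infDist_ge_add_mul hX hne hbX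
      (Set.disjoint_left.1 hdisj hbρ) hc0.le hc (sub_pos.2 hlt)
    have htri := dist_triangle b' b a
    have hle : infDist b' X ≤ infDist b X := hmax
      ⟨by rw [mem_closedBall]; linarith, by
        simp only [Set.mem_ofPred_eq]
        nlinarith [mul_le_mul_of_nonneg_left htri hc0.le]⟩
    nlinarith [mul_pos hc0 hb'0]
  · exact ⟨b, heq, by rw [← heq]; exact hb⟩

/-- On a closed ball off the medial axis, the distance function grows by exactly the radius at
some point of the boundary sphere. -/
theorem exists_infDist_eq_add_of_disjoint {X : Set E} (hX : IsClosed X) (hne : X.Nonempty)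
    {a : E} (haX : a ∉ X) {ρ : ℝ} (hρ : 0 < ρ)
    (hdisj : Disjoint (closedBall a ρ) (medialAxis X)) :
    ∃ b ∈ sphere a ρ, infDist b X = infDist a X + ρ := by
  have hcont := continuous_infDist_pt X
  obtain ⟨b₀, hb₀, -⟩ := exists_infDist_ge_add_mul_of_disjoint hX hne haX hρ hdisj
    (c := 1 / 2) (by norm_num) (by norm_num)
  obtain ⟨b, hb, hmax⟩ := (isCompact_sphere a ρ).exists_isMaxOn ⟨b₀, hb₀⟩ hcont.continuousOn
  refine ⟨b, hb, le_antisymm ?_ ?_⟩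
  · have := infDist_le_infDist_add_dist (s := X) (x := b) (y := a)
    rwa [mem_sphere.1 hb] at this
  · have hlim : Tendsto (fun c : ℝ => infDist a X + c * ρ) (𝓝[<] 1) (𝓝 (infDist a X + ρ)) := by
      have : Continuous (fun c : ℝ => infDist a X + c * ρ) := by fun_prop
      simpa using (this.tendsto 1).mono_left nhdsWithin_le_nhds
    refine le_of_tendsto hlim ?_
    filter_upwards [Ioo_mem_nhdsLT (zero_lt_one (α := ℝ))] with c hc
    obtain ⟨b', hb', h⟩ :=
      exists_infDist_ge_add_mul_of_disjoint hX hne haX hρ hdisj hc.1 hc.2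
    exact h.trans (hmax hb')

/-- A segment realising the distance to `X` extends across a ball off the medial axis. -/
theorem infDist_add_smul_extend {X : Set E} (hX : IsClosed X) {p u : E} (hpX : p ∈ X)
    (hu : ‖u‖ = 1) {τ ρ : ℝ} (hτ : 0 < τ) (hρ : 0 < ρ) (hd : infDist (p + τ • u) X = τ)
    (hdisj : Disjoint (closedBall (p + τ • u) ρ) (medialAxis X)) :
    infDist (p + (τ + ρ) • u) X = τ + ρ := by
  have hne : X.Nonempty := ⟨p, hpX⟩
  obtain ⟨b, hb, hbd⟩ := exists_infDist_eq_add_of_disjoint hX hne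
    ((hX.notMem_iff_infDist_pos hne).2 (by rwa [hd])) hρ hdisj
  rw [hd] at hbd
  rw [mem_sphere, dist_eq_norm] at hb
  set w := b - (p + τ • u) with hw
  have hτu : ‖τ • u‖ = τ := by rw [norm_smul, hu, Real.norm_of_nonneg hτ.le, mul_one]
  have hle : τ + ρ ≤ ‖τ • u + w‖ := by
    have : τ • u + w = b - p := by rw [hw]; abel
    rw [this, ← dist_eq_norm, ← hbd]
    exact infDist_le_dist_of_mem hpX
  have hray : SameRay ℝ (τ • u) w := by
    rw [sameRay_iff_norm_add]
    refine le_antisymm (norm_add_le _ _) ?_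
    rwa [hτu, hb]
  have hwu : w = ρ • u := by
    have h := hray.norm_smul_eq
    rw [hτu, hb, smul_comm] at h
    exact (smul_right_injective E hτ.ne' h.symm).symm
  have hb' : b = p + (τ + ρ) • u := by
    rw [add_smul, ← hwu, hw]; abel
  rw [← hb', hbd]

/-- A segment realising the distance to `X` extends as long as it avoids the closure of the
medial axis. -/
theorem infDist_add_smul_eq_of_forall_notMem_closure {X : Set E} (hX : IsClosed X) {p u : E}
    (hpX : p ∈ X) (hu : ‖u‖ = 1) {τ r : ℝ} (hτ : 0 < τ) (hτr : τ ≤ r)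
    (hd : infDist (p + τ • u) X = τ)
    (hM : ∀ t ∈ Set.Ico τ r, p + t • u ∉ closure (medialAxis X)) :
    infDist (p + r • u) X = r := by
  have hclosed : IsClosed {t : ℝ | infDist (p + t • u) X = t} :=
    isClosed_eq ((continuous_infDist_pt X).comp (by fun_prop)) continuous_id
  refine (hclosed.inter isClosed_Icc).mem_of_ge_of_forall_exists_gt
    (s := {t : ℝ | infDist (p + t • u) X = t}) hd hτr ?_
  rintro t ⟨ht, htm⟩
  obtain ⟨ρ, hρ, hsub⟩ := nhds_basis_closedBall.mem_iff.1
    (isClosed_closure.isOpen_compl.mem_nhds (hM t htm))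
  have hmin : 0 < min ρ (r - t) := lt_min hρ (sub_pos.2 htm.2)
  refine ⟨t + min ρ (r - t), ?_, by linarith, by linarith [min_le_right ρ (r - t)]⟩
  refine infDist_add_smul_extend hX hpX hu (hτ.trans_le htm.1) hmin ht ?_
  refine Set.disjoint_left.2 fun y hy hyM => ?_
  exact hsub (closedBall_subset_closedBall (min_le_left _ _) hy) (subset_closure hyM)

/-- A normal vector at `0` is almost nonpositive on small vectors of `X`. -/
theorem exists_inner_le_of_normal {X : Set E} {v : E}
    (hnormal : ∀ w ∈ peanoCone X 0, ⟪v, w⟫ ≤ 0) {δ : ℝ} (hδ : 0 < δ) :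
    ∃ s > 0, ∀ y ∈ X, ‖y‖ < s → ⟪v, y⟫ ≤ δ * ‖y‖ := by
  by_contra! hcon
  choose y hyX hys hy using fun k : ℕ => hcon (1 / ((k : ℝ) + 1)) (by positivity)
  have hy0 : ∀ k, 0 < ‖y k‖ := fun k => by
    rw [norm_pos_iff]
    intro h
    have := hy k
    simp [h] at this
  have hnorm : ∀ k, ‖‖y k‖⁻¹ • y k‖ = 1 := fun k => by
    rw [norm_smul, norm_inv, norm_norm, inv_mul_cancel₀ (hy0 k).ne']
  obtain ⟨w, -, φ, hφ, hw⟩ := (isCompact_sphere (0 : E) 1).tendsto_subseq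
    (x := fun k => ‖y k‖⁻¹ • y k) fun k => by simpa using hnorm k
  have hy_lim : Tendsto y atTop (𝓝 0) :=
    squeeze_zero_norm (fun k => (hys k).le) tendsto_one_div_add_atTop_nhds_zero_nat
  have hwc : w ∈ peanoCone X 0 := by
    refine ⟨y ∘ φ, fun k => ‖y (φ k)‖⁻¹, fun k => hyX _, hy_lim.comp hφ.tendsto_atTop,
      fun k => inv_pos.2 (hy0 _), ?_⟩
    simpa [Function.comp_def] using hw
  have hδw : δ ≤ ⟪v, w⟫ := by
    refine ge_of_tendsto (Tendsto.inner tendsto_const_nhds hw) (Eventually.of_forall fun k => ?_)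
    simp only [Function.comp_apply, inner_smul_right]
    rw [inv_mul_eq_div, le_div_iff₀ (hy0 _)]
    exact (hy _).le
  linarith [hnormal w hwc]

/-- Nearest points to `s • v`, for `v` a unit normal vector at `0`, are `o(s)`. -/
theorem exists_norm_nearestPts_le_of_normal {X : Set E} (h0 : (0 : E) ∈ X) {v : E}
    (hv : ‖v‖ = 1) (hnormal : ∀ w ∈ peanoCone X 0, ⟪v, w⟫ ≤ 0) {δ : ℝ} (hδ : 0 < δ) :
    ∃ s₀ > 0, ∀ s, 0 < s → s < s₀ → ∀ p ∈ nearestPts X (s • v), ‖p‖ ≤ δ * s := by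
  obtain ⟨s₁, hs₁, h⟩ := exists_inner_le_of_normal hnormal (half_pos hδ)
  refine ⟨s₁ / 2, half_pos hs₁, fun s hs hss p ⟨hpX, hp⟩ => ?_⟩
  have hsv : ‖s • v‖ = s := by rw [norm_smul, hv, Real.norm_of_nonneg hs.le, mul_one]
  have hle : ‖s • v - p‖ ≤ s := by
    rw [← dist_eq_norm, hp]
    exact (infDist_le_dist_of_mem h0).trans (by rw [dist_zero_right, hsv])
  have hp2 : ‖p‖ ≤ 2 * s := by
    have := norm_sub_norm_le p (s • v)
    rw [norm_sub_rev, hsv] at this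
    linarith
  have hin := h p hpX (by linarith)
  have hsq := norm_sub_sq_real (s • v) p
  rw [hsv, real_inner_smul_left] at hsq
  rcases (norm_nonneg p).eq_or_lt with h | hpos
  · rw [← h]; positivity
  · refine le_of_mul_le_mul_right ?_ hpos
    nlinarith [norm_nonneg (s • v - p), mul_le_mul_of_nonneg_left hin hs.le]

/-- If the closure of the medial axis misses a conical neighbourhood of the segment from `0` to
`r • v`, for `v` a unit normal vector at `0`, then `r • v` has distance at least `r` to `X`. -/
theorem le_infDist_smul_of_normal {X : Set E} (hX : IsClosed X) (h0 : (0 : E) ∈ X) {v : E}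
    (hv : ‖v‖ = 1) (hnormal : ∀ w ∈ peanoCone X 0, ⟪v, w⟫ ≤ 0) {r ε : ℝ} (hr : 0 < r)
    (hε : 0 < ε)
    (hM : ∀ a ∈ closure (medialAxis X), ∀ t, 0 < t → t < r → ε * t < ‖a - t • v‖) :
    r ≤ infDist (r • v) X := by
  have key : ∀ δ, 0 < δ → δ ≤ 1 / 2 → 6 * δ ≤ ε → r - 6 * δ * r ≤ infDist (r • v) X := by
    intro δ hδ hδ2 hδε
    obtain ⟨s₀, hs₀, h⟩ := exists_norm_nearestPts_le_of_normal h0 hv hnormal hδ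
    set s := min (s₀ / 2) r with hs_def
    have hs : 0 < s := lt_min (half_pos hs₀) hr
    have hsr : s ≤ r := min_le_right _ _
    have hss : s < s₀ := (min_le_left _ _).trans_lt (half_lt_self hs₀)
    obtain ⟨p, hpX, hp⟩ := hX.exists_infDist_eq_dist ⟨0, h0⟩ (s • v)
    have hpn := h s hs hss p ⟨hpX, hp.symm⟩
    obtain ⟨hhalf, hunit⟩ := norm_inv_norm_smul_sub_le hv hδ2 hs hpn
    set τ := ‖s • v - p‖ with hτ_def
    set u := τ⁻¹ • (s • v - p) with hu_def
    have hτ : 0 < τ := by linarith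
    have hτs : τ ≤ s := by
      rw [hτ_def, ← dist_eq_norm, ← hp]
      refine (infDist_le_dist_of_mem h0).trans ?_
      rw [dist_zero_right, norm_smul, hv, Real.norm_of_nonneg hs.le, mul_one]
    have hu : ‖u‖ = 1 := by
      rw [hu_def, norm_smul, norm_inv, Real.norm_of_nonneg hτ.le, ← hτ_def,
        inv_mul_cancel₀ hτ.ne']
    have hpu : p + τ • u = s • v := by
      rw [hu_def, smul_inv_smul₀ hτ.ne']; abel
    have hnear : ∀ t, τ ≤ t → ‖p + t • u - t • v‖ ≤ 6 * δ * t := by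
      intro t ht
      have ht0 : 0 < t := hτ.trans_le ht
      have h1 : p + t • u - t • v = p + t • (u - v) := by rw [smul_sub]; abel
      have h2 := norm_add_le p (t • (u - v))
      rw [norm_smul, Real.norm_of_nonneg ht0.le] at h2
      rw [h1]
      nlinarith [mul_le_mul_of_nonneg_left hunit ht0.le,
        mul_le_mul_of_nonneg_left (hhalf.trans ht) hδ.le]
    have hray : infDist (p + r • u) X = r := by
      refine infDist_add_smul_eq_of_forall_notMem_closure hX hpX hu hτ (hτs.trans hsr) ?_ ?_
      · rw [hpu, hp, dist_eq_norm]
      · intro t ht hmem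
        have ht0 : 0 < t := hτ.trans_le ht.1
        have h1 := hM _ hmem t ht0 ht.2
        have h2 := hnear t ht.1
        have h3 := mul_le_mul_of_nonneg_right hδε ht0.le
        linarith
    have h1 := infDist_le_infDist_add_dist (s := X) (x := p + r • u) (y := r • v)
    rw [hray, dist_eq_norm] at h1
    linarith [hnear r (hτs.trans hsr)]
  have hlim : Tendsto (fun δ : ℝ => r - 6 * δ * r) (𝓝[>] 0) (𝓝 r) := by
    have : Continuous (fun δ : ℝ => r - 6 * δ * r) := by fun_prop
    simpa using (this.tendsto 0).mono_left nhdsWithin_le_nhds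
  refine le_of_tendsto hlim ?_
  have hmin : 0 < min (1 / 2) (ε / 6) := by positivity
  filter_upwards [Ioo_mem_nhdsGT hmin] with δ hδ
  have h1 := hδ.2.trans_le (min_le_left _ _)
  have h2 := hδ.2.trans_le (min_le_right _ _)
  exact key δ hδ.1 h1.le (by linarith)

end MedialAxis

/-- If arbitrarily small `t` admit points of `S` within `o(t)` of `t • v`, then `v` lies in the
tangent cone of `S` at `0`, and `0` in the closure of `S`. -/
theorem mem_closure_and_mem_peanoCone {E : Type*} [NormedAddCommGroup E] [NormedSpace ℝ E]
    {S : Set E} {v : E} (h : ∀ ε > 0, ∃ a ∈ S, ∃ t, 0 < t ∧ t < ε ∧ ‖a - t • v‖ ≤ ε * t) :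
    (0 : E) ∈ closure S ∧ v ∈ peanoCone S 0 := by
  choose a haS t ht htε hat using fun k : ℕ => h (1 / ((k : ℝ) + 1)) (by positivity)
  have hε := tendsto_one_div_add_atTop_nhds_zero_nat (𝕜 := ℝ)
  have ht_lim : Tendsto t atTop (𝓝 0) :=
    squeeze_zero (fun k => (ht k).le) (fun k => (htε k).le) hε
  have ha_lim : Tendsto a atTop (𝓝 0) := by
    have h1 : Tendsto (fun k => a k - t k • v) atTop (𝓝 0) :=
      squeeze_zero_norm hat (by simpa using hε.mul ht_lim)
    simpa using h1.add (ht_lim.smul_const v)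
  refine ⟨mem_closure_of_tendsto ha_lim (Eventually.of_forall haS),
    a, fun k => (t k)⁻¹, haS, ha_lim, fun k => inv_pos.2 (ht k), ?_⟩
  rw [tendsto_iff_norm_sub_tendsto_zero]
  refine squeeze_zero (fun _ => norm_nonneg _) (fun k => ?_) hε
  have : (t k)⁻¹ • (a k - 0) - v = (t k)⁻¹ • (a k - t k • v) := by
    rw [sub_zero, smul_sub, inv_smul_smul₀ (ht k).ne']
  rw [this, norm_smul, norm_inv, Real.norm_of_nonneg (ht k).le, inv_mul_le_iff₀ (ht k), mul_comm]
  exact hat k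

/-- let `X ⊆ ℝⁿ` be a nonempty proper closed set with `0 ∈ X` and let
`v` be a unit normal direction at `0`. If there is a sequence `x_ν ∈ X`, `x_ν → 0`,
with `⟪x_ν, v⟫ > 0` and `‖x_ν‖²/⟪x_ν, v⟫ → 0`, then `0 ∈ closure M_X` and
`v` belongs to the Peano tangent cone of `closure M_X` at `0`. -/
theorem stmt4 (n : ℕ) (X : Set (EuclideanSpace ℝ (Fin n))) (hne : X.Nonempty)
    (hprop : X ≠ Set.univ) (hX : IsClosed X)
    (h0 : (0 : EuclideanSpace ℝ (Fin n)) ∈ X)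
    (v : EuclideanSpace ℝ (Fin n)) (hv : ‖v‖ = 1)
    (hnormal : ∀ w ∈ peanoCone X 0, ⟪v, w⟫ ≤ 0)
    (x : ℕ → EuclideanSpace ℝ (Fin n)) (hxX : ∀ ν, x ν ∈ X)
    (hx0 : Tendsto x atTop (𝓝 0)) (hpos : ∀ ν, 0 < ⟪x ν, v⟫)
    (hquot : Tendsto (fun ν => ‖x ν‖ ^ 2 / ⟪x ν, v⟫) atTop (𝓝 0)) :
    (0 : EuclideanSpace ℝ (Fin n)) ∈ closure (medialAxis X) ∧
    v ∈ peanoCone (closure (medialAxis X)) 0 := by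
  suffices h : ∀ ε > 0, ∃ a ∈ closure (medialAxis X), ∃ t, 0 < t ∧ t < ε ∧
      ‖a - t • v‖ ≤ ε * t by
    simpa only [closure_closure] using mem_closure_and_mem_peanoCone h
  intro ε hε
  by_contra! hM
  have hle := le_infDist_smul_of_normal hX h0 hv hnormal hε hε hM
  obtain ⟨ν, hν⟩ := (hquot.eventually (gt_mem_nhds (by positivity : 0 < 2 * ε))).exists
  rw [div_lt_iff₀ (hpos ν)] at hν
  have hx := hle.trans (infDist_le_dist_of_mem (hxX ν))
  have hsq := norm_sub_sq_real (ε • v) (x ν)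
  rw [norm_smul, hv, Real.norm_of_nonneg hε.le, mul_one, real_inner_smul_left,
    real_inner_comm, ← dist_eq_norm] at hsq
  nlinarith
end
end

section
/- Let 1 ≤ k < n and let X ⊆ ℝⁿ = ℝ^k × ℝ^{n−k} be a closed set with 0 ∈ X, and assume there exist C₀ > 0 and a neighbourhood U₀ of 0 with X ∩ U₀ ⊆ {(x, y) : ‖y‖ ≤ C₀‖x‖}. Then the general curvature equals the infimum of the directional curvatures over all camber directions: θ(X,0) = inf{θ_v(X,0) : v a unit vector in {0}^k × ℝ^{n−k}}. -/
open Filter Topology Metric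
open scoped ENNReal

noncomputable section

local notation "⟪" x ", " y "⟫" => @inner ℝ _ _ x y

/-- ℝⁿ = ℝ^k × ℝ^{n-k} with the Euclidean (ℓ²) norm. -/
abbrev Amb (k m : ℕ) := WithLp 2 (EuclideanSpace ℝ (Fin k) × EuclideanSpace ℝ (Fin m))

/-- First (horizontal) component of a point of ℝ^k × ℝ^{n-k}. -/
def hor {k m : ℕ} (p : Amb k m) : EuclideanSpace ℝ (Fin k) := (WithLp.equiv 2 _ p).1

/-- Second (vertical) component of a point of ℝ^k × ℝ^{n-k}. -/
def ver {k m : ℕ} (p : Amb k m) : EuclideanSpace ℝ (Fin m) := (WithLp.equiv 2 _ p).2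

/-- The directional curvature `θ_v(X,0)` of `X` at `0` in the direction of a unit
vector `v`, as a supremum in `[0,+∞]` with `sup ∅ = 0`. -/
def dirCurv {k m : ℕ} (X : Set (Amb k m)) (v : Amb k m) : ℝ≥0∞ :=
  sSup (ENNReal.ofReal ''
    {θ : ℝ | 0 < θ ∧ ∃ c > (0 : ℝ), ∃ U ∈ 𝓝 (0 : Amb k m),
      ∀ p ∈ X ∩ U, |⟪p, v⟫| ≤ c * ‖p - ⟪p, v⟫ • v‖ ^ θ})

/-- The general curvature `θ(X,0)` of `X ⊆ ℝ^k × ℝ^{n-k}` at `0`, as a supremum in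
`[0,+∞]` with `sup ∅ = 0`. -/
def genCurv {k m : ℕ} (X : Set (Amb k m)) : ℝ≥0∞ :=
  sSup (ENNReal.ofReal ''
    {θ : ℝ | 0 < θ ∧ ∃ C > (0 : ℝ), ∃ U ∈ 𝓝 (0 : Amb k m),
      X ∩ U ⊆ {p : Amb k m | ‖ver p‖ ≤ C * ‖hor p‖ ^ θ}})

/-- The inner product with a vertical vector only sees vertical components. -/
lemma inner_eq_inner_ver {k m : ℕ} (p v : Amb k m) (hv : hor v = 0) :
    ⟪p, v⟫ = ⟪ver p, ver v⟫ := by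
  have h : v.fst = 0 := hv
  simp [WithLp.prod_inner_apply, h, ver]

lemma norm_ver_le {k m : ℕ} (p : Amb k m) : ‖ver p‖ ≤ ‖p‖ :=
  WithLp.norm_snd_le _ p

lemma norm_hor_le {k m : ℕ} (p : Amb k m) : ‖hor p‖ ≤ ‖p‖ :=
  WithLp.norm_fst_le _ p

lemma norm_le_hor_add_ver {k m : ℕ} (p : Amb k m) : ‖p‖ ≤ ‖hor p‖ + ‖ver p‖ := by
  rw [WithLp.prod_norm_eq_of_L2]
  refine Real.sqrt_le_iff.2 ⟨by positivity, ?_⟩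
  change ‖hor p‖ ^ 2 + ‖ver p‖ ^ 2 ≤ _
  nlinarith [mul_nonneg (norm_nonneg (hor p)) (norm_nonneg (ver p))]

lemma hor_sub_smul {k m : ℕ} (p v : Amb k m) (a : ℝ) (hv : hor v = 0) :
    hor (p - a • v) = hor p := by
  have h : v.fst = 0 := hv
  change (p - a • v).fst = p.fst
  simp [h]

/-- The general curvature is at most every directional curvature in a vertical direction. -/
lemma genCurv_le_dirCurv {k m : ℕ} (X : Set (Amb k m)) (v : Amb k m)
    (hv : ‖v‖ = 1) (hv0 : hor v = 0) : genCurv X ≤ dirCurv X v := by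
  refine sSup_le_sSup (Set.image_mono ?_)
  rintro θ ⟨hθ, C, hC, U, hU, hXU⟩
  refine ⟨hθ, C, hC, U, hU, fun p hp => ?_⟩
  have hver : ‖ver v‖ ≤ 1 := hv ▸ norm_ver_le v
  calc |⟪p, v⟫| = |⟪ver p, ver v⟫| := by rw [inner_eq_inner_ver p v hv0]
    _ ≤ ‖ver p‖ * ‖ver v‖ := abs_real_inner_le_norm _ _
    _ ≤ ‖ver p‖ := mul_le_of_le_one_right (norm_nonneg _) hver
    _ ≤ C * ‖hor p‖ ^ θ := hXU hp
    _ ≤ C * ‖p - ⟪p, v⟫ • v‖ ^ θ := by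
      have h := norm_hor_le (p - ⟪p, v⟫ • v)
      rw [hor_sub_smul p v _ hv0] at h
      gcongr

/-- The `i`-th vertical unit coordinate vector. -/
def vertBasis (k m : ℕ) (i : Fin m) : Amb k m :=
  WithLp.toLp 2 (0, EuclideanSpace.single i 1)

lemma hor_vertBasis {k m : ℕ} (i : Fin m) : hor (vertBasis k m i) = 0 := rfl

lemma norm_vertBasis {k m : ℕ} (i : Fin m) : ‖vertBasis k m i‖ = 1 := by
  simp [vertBasis]

lemma inner_vertBasis {k m : ℕ} (p : Amb k m) (i : Fin m) :
    ⟪p, vertBasis k m i⟫ = ver p i := by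
  rw [inner_eq_inner_ver p _ (hor_vertBasis i)]
  simp [vertBasis, ver, EuclideanSpace.inner_single_right]

lemma norm_le_sum_abs {m : ℕ} (y : EuclideanSpace ℝ (Fin m)) : ‖y‖ ≤ ∑ i, |y i| := by
  rw [EuclideanSpace.norm_eq]
  refine Real.sqrt_le_iff.2 ⟨Finset.sum_nonneg fun i _ => abs_nonneg _, ?_⟩
  exact Finset.sum_sq_le_sq_sum_of_nonneg fun i _ => abs_nonneg (y i)

/-- Below the directional curvature, the component along a unit vector `v` is controlled by a
power of the full norm. -/
lemma exists_abs_inner_le_of_lt_dirCurv {k m : ℕ} {X : Set (Amb k m)} {v : Amb k m}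
    (hv : ‖v‖ = 1) {t : ℝ} (ht : 0 < t) (h : ENNReal.ofReal t < dirCurv X v) :
    ∃ c > (0 : ℝ), ∀ᶠ p in 𝓝 (0 : Amb k m), p ∈ X → |⟪p, v⟫| ≤ c * ‖p‖ ^ t := by
  obtain ⟨_, ⟨θ, ⟨hθ, c, hc, U, hU, hXU⟩, rfl⟩, hlt⟩ := lt_sSup_iff.1 h
  have htθ : t < θ := (ENNReal.ofReal_lt_ofReal_iff hθ).1 hlt
  refine ⟨c, hc, ?_⟩
  filter_upwards [hU, closedBall_mem_nhds (0 : Amb k m) one_pos] with p hpU hp1 hpX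
  have hp1 : ‖p‖ ≤ 1 := mem_closedBall_zero_iff.1 hp1
  have hproj : ‖p - ⟪p, v⟫ • v‖ ≤ ‖p‖ := by
    refine le_of_sq_le_sq ?_ (norm_nonneg _)
    rw [norm_sub_sq_real, inner_smul_right, norm_smul, hv, Real.norm_eq_abs, mul_one, sq_abs]
    nlinarith [sq_nonneg ⟪p, v⟫]
  calc |⟪p, v⟫| ≤ c * ‖p - ⟪p, v⟫ • v‖ ^ θ := hXU p ⟨hpX, hpU⟩
    _ ≤ c * ‖p‖ ^ θ := by gcongr
    _ ≤ c * ‖p‖ ^ t := by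
      gcongr 1
      exact Real.rpow_le_rpow_of_exponent_ge' (norm_nonneg _) hp1 ht.le htθ.le

/-- if `X ⊆ ℝ^k × ℝ^{n-k}` is closed, contains `0` and lies near `0` in a
horizontal cone `{‖y‖ ≤ C₀‖x‖}`, then the general curvature of `X` at `0` is the infimum
of the directional curvatures over all camber directions, i.e. over all unit vectors of
`{0}^k × ℝ^{n-k}`. -/
theorem stmt7 (n k : ℕ) (hk : 1 ≤ k) (hkn : k < n)
    (X : Set (Amb k (n - k))) (hX : IsClosed X) (h0 : (0 : Amb k (n - k)) ∈ X)
    (C₀ : ℝ) (hC₀ : 0 < C₀) (U₀ : Set (Amb k (n - k))) (hU₀ : U₀ ∈ 𝓝 (0 : Amb k (n - k)))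
    (hcone : X ∩ U₀ ⊆ {p : Amb k (n - k) | ‖ver p‖ ≤ C₀ * ‖hor p‖}) :
    genCurv X =
      sInf (dirCurv X '' {v : Amb k (n - k) | ‖v‖ = 1 ∧ hor v = 0}) := by
  refine le_antisymm ?_ ?_
  · refine le_sInf ?_
    rintro _ ⟨v, ⟨hv, hv0⟩, rfl⟩
    exact genCurv_le_dirCurv X v hv hv0
  refine le_of_forall_lt_imp_le_of_dense fun a ha => ?_
  obtain rfl | ha0 := eq_or_ne a 0
  · exact zero_le
  have hatop : a ≠ ⊤ := ha.ne_top
  set t := a.toReal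
  have ht : 0 < t := ENNReal.toReal_pos ha0 hatop
  have hat : ENNReal.ofReal t = a := ENNReal.ofReal_toReal hatop
  have hbound (i : Fin (n - k)) := exists_abs_inner_le_of_lt_dirCurv (X := X)
    (norm_vertBasis (k := k) i) ht (hat ▸ ha.trans_le
      (sInf_le ⟨_, ⟨norm_vertBasis i, hor_vertBasis i⟩, rfl⟩))
  choose c hc hev using hbound
  have hsum : 0 ≤ ∑ i, c i := Finset.sum_nonneg fun i _ => (hc i).le
  refine le_sSup ⟨t, ⟨ht, ((∑ i, c i) + 1) * (1 + C₀) ^ t, by positivity, _,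
    inter_mem hU₀ (eventually_all.2 hev), ?_⟩, hat⟩
  rintro p ⟨hpX, hpU₀, hp⟩
  have hp (i : Fin (n - k)) : |ver p i| ≤ c i * ‖p‖ ^ t := inner_vertBasis p i ▸ hp i hpX
  have hcone_p : ‖ver p‖ ≤ C₀ * ‖hor p‖ := hcone ⟨hpX, hpU₀⟩
  have hnorm : ‖p‖ ≤ (1 + C₀) * ‖hor p‖ := by linarith [norm_le_hor_add_ver p]
  calc ‖ver p‖ ≤ ∑ i, |ver p i| := norm_le_sum_abs _
    _ ≤ ∑ i, c i * ‖p‖ ^ t := Finset.sum_le_sum fun i _ => hp i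
    _ = (∑ i, c i) * ‖p‖ ^ t := (Finset.sum_mul ..).symm
    _ ≤ ((∑ i, c i) + 1) * ((1 + C₀) * ‖hor p‖) ^ t := by gcongr; linarith
    _ = ((∑ i, c i) + 1) * (1 + C₀) ^ t * ‖hor p‖ ^ t := by
      rw [Real.mul_rpow (by positivity) (norm_nonneg _), mul_assoc]
end
end
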